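/- arXiv:1211.7317 — 2 statements merged into one kernel-verified Lean document; each statement's English description precedes it below -/
import Mathlib

section
/- Let U ⊆ ℝⁿ be open, let f : ℝⁿ → ℝⁿ be continuously differentiable, let ω ∈ ℝ, and let Θ : U → ℝ be twice continuously differentiable with ⟨∇Θ(x), f(x)⟩ = ω for all x ∈ U. Let x : ℝ → U be differentiable with x'(t) = f(x(t)) for all t ∈ ℝ. Then the curve q(t) := ∇Θ(x(t)) is differentiable and satisfies the adjoint equation q'(t) = −(Df(x(t)))ᵀ q(t) for all t ∈ ℝ, where Df denotes the Jacobian matrix of f and (·)ᵀ the matrix transpose. Moreover, if x is T-periodic then q is T-periodic. -/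
open scoped RealInnerProductSpace

/-- If `Θ` is `C²` on an open set `U`, `f` is `C¹`, and the normalization
`⟪∇Θ(x), f(x)⟫ = ω` holds on `U`, then along any solution of `x' = f(x)` staying in `U`
the curve `q(t) = ∇Θ(x(t))` is differentiable and satisfies the adjoint (Malkin) equation
`q'(t) = -(Df(x(t)))ᵀ q(t)` (the transpose being the adjoint for the real inner product);
moreover if `x` is `T`-periodic then so is `q`. -/
theorem stmt_9 {n : ℕ} (U : Set (EuclideanSpace ℝ (Fin n))) (hU : IsOpen U)
    (f : EuclideanSpace ℝ (Fin n) → EuclideanSpace ℝ (Fin n)) (hf : ContDiff ℝ 1 f)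
    (ω : ℝ) (Θ : EuclideanSpace ℝ (Fin n) → ℝ) (hΘ : ContDiffOn ℝ 2 Θ U)
    (hnorm : ∀ x ∈ U, ⟪gradient Θ x, f x⟫ = ω)
    (x : ℝ → EuclideanSpace ℝ (Fin n)) (hxU : ∀ t, x t ∈ U)
    (hx : ∀ t : ℝ, HasDerivAt x (f (x t)) t) :
    (∀ t : ℝ, HasDerivAt (fun s => gradient Θ (x s))
        (-(ContinuousLinearMap.adjoint (fderiv ℝ f (x t))) (gradient Θ (x t))) t) ∧
    (∀ T : ℝ, Function.Periodic x T → Function.Periodic (fun s => gradient Θ (x s)) T) := by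
  have hg : ∀ y v, ⟪gradient Θ y, v⟫ = fderiv ℝ Θ y v := by
    intro y v
    simp [gradient]
  refine ⟨fun t => ?_, fun T hT s => ?_⟩
  · have hUn : U ∈ nhds (x t) := hU.mem_nhds (hxU t)
    have hc : ContDiffAt ℝ 2 Θ (x t) := hΘ.contDiffAt hUn
    have hsymm : IsSymmSndFDerivAt ℝ Θ (x t) := hc.isSymmSndFDerivAt (by simp)
    have hc1 : ContDiffAt ℝ 1 (fderiv ℝ Θ) (x t) :=
      hc.fderiv_right (m := 1) (by norm_num)
    have hH := (hc1.differentiableAt (by norm_num)).hasFDerivAt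
    have hF := (hf.differentiable (by norm_num) (x t)).hasFDerivAt
    have hprod := hH.clm_apply hF
    have hconst : (fun y => fderiv ℝ Θ y (f y)) =ᶠ[nhds (x t)] fun _ => ω := by
      filter_upwards [hUn] with y hy
      rw [← hg, hnorm y hy]
    have hzero := hprod.unique ((hasFDerivAt_const ω (x t)).congr_of_eventuallyEq hconst)
    have hcomp := hH.comp_hasDerivAt t (hx t)
    have hq := ((InnerProductSpace.toDual ℝ
      (EuclideanSpace ℝ (Fin n))).symm.toContinuousLinearEquiv.toContinuousLinearMap.hasFDerivAt
      (x := fderiv ℝ Θ (x t))).comp_hasDerivAt t hcomp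
    refine HasDerivAt.congr_deriv hq ?_
    refine ext_inner_right ℝ fun v => ?_
    have hz := congrArg (fun L => L v) hzero
    have hs := hsymm.eq (f (x t)) v
    simp at hz
    have e1 : ⟪-(ContinuousLinearMap.adjoint (fderiv ℝ f (x t))) (gradient Θ (x t)), v⟫
        = - fderiv ℝ Θ (x t) (fderiv ℝ f (x t) v) := by
      rw [inner_neg_left, ContinuousLinearMap.adjoint_inner_left, hg]
    rw [e1]
    have e2 : ⟪(InnerProductSpace.toDual ℝ (EuclideanSpace ℝ (Fin n))).symm
        (fderiv ℝ (fderiv ℝ Θ) (x t) (f (x t))), v⟫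
        = fderiv ℝ (fderiv ℝ Θ) (x t) (f (x t)) v := by simp
    refine e2.trans ?_
    linarith
  · simp only [hT s]
end

section
/- Let f : ℝⁿ × ℝ → ℝⁿ be twice continuously differentiable, let ω : ℝ → ℝ be differentiable at λ₀ with ω(λ₀) > 0, let x̃ : ℝ × ℝ → ℝⁿ be continuously differentiable, and let q : ℝ × ℝ → ℝⁿ be twice continuously differentiable and satisfy ω(λ) · ∂q/∂θ(θ, λ) = −A(θ, λ)ᵀ q(θ, λ) for all (θ, λ) in a neighborhood of ℝ × {λ₀}, where A(θ, λ) = ∂f/∂x(x̃(θ, λ), λ). Then the sensitivity Z_q(θ) := ∂q/∂λ(θ, λ₀) satisfies, for all θ, the linear differential equation Z_q'(θ) + (1/ω(λ₀)) A(θ, λ₀)ᵀ Z_q(θ) + (1/ω(λ₀)) C(θ)ᵀ q(θ, λ₀) = 0, where the matrix C(θ) has entries C_{ij}(θ) = Σ_{k=1}^{n} ∂²f_i/∂x_j∂x_k(x̃(θ, λ₀), λ₀) · Z_k(θ) + ∂²f_i/∂x_j∂λ(x̃(θ, λ₀), λ₀) − (ω'(λ₀)/ω(λ₀)) ∂f_i/∂x_j(x̃(θ,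 λ₀), λ₀), with Z(θ) = ∂x̃/∂λ(θ, λ₀). -/
theorem aux_G {n : ℕ} (f : (Fin n → ℝ) × ℝ → (Fin n → ℝ)) (hf : ContDiff ℝ 2 f)
    (y v : Fin n → ℝ) (l : ℝ) (i : Fin n) :
    fderiv ℝ (fun z => f (z, l) i) y v = fderiv ℝ f (y, l) (v, 0) i := by
  have h1 : HasFDerivAt f (fderiv ℝ f (y, l)) (y, l) :=
    (hf.differentiable (by norm_num) _).hasFDerivAt
  have h2 : HasFDerivAt (fun z : Fin n → ℝ => (z, l))
      (ContinuousLinearMap.inl ℝ (Fin n → ℝ) ℝ) y := hasFDerivAt_prodMk_left y l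
  have h3 := h1.comp y h2
  have h4 := (hasFDerivAt_pi'.1 h3) i
  have h5 : fderiv ℝ (fun z => f (z, l) i) y = _ := h4.fderiv
  rw [h5]
  simp

theorem aux_sum {n : ℕ} (L : (Fin n → ℝ) →L[ℝ] ℝ) (z : Fin n → ℝ) :
    ∑ k, L (Pi.single k 1) * z k = L z := by
  conv_rhs => rw [pi_eq_sum_univ' z, map_sum]
  refine Finset.sum_congr rfl fun k _ => ?_
  rw [map_smul, smul_eq_mul, mul_comm]

/-- Sensitivity equation of the state infinitesimal phase response curve.
If `ω(l) • ∂q/∂θ(θ, l) = -A(θ, l)ᵀ q(θ, l)` for all `θ` and all `l` near `l₀`, where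
`A(θ, l)` is the Jacobian `∂f/∂x(xt(θ, l), l)`, then the sensitivity
`Z_q(θ) = ∂q/∂λ(θ, l₀)` satisfies
`Z_q'(θ) + (1/ω₀) A(θ, l₀)ᵀ Z_q(θ) + (1/ω₀) C(θ)ᵀ q(θ, l₀) = 0` with
`C_ij(θ) = Σ_k ∂²f_i/∂x_j∂x_k · Z_k(θ) + ∂²f_i/∂x_j∂λ - (ω'(l₀)/ω₀) ∂f_i/∂x_j`,
all evaluated at `(xt(θ, l₀), l₀)`, where `Z(θ) = ∂xt/∂λ(θ, l₀)`. -/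
theorem stmt_12 {n : ℕ}
    (f : (Fin n → ℝ) × ℝ → (Fin n → ℝ)) (hf : ContDiff ℝ 2 f)
    (ω : ℝ → ℝ) (l₀ : ℝ) (hω : DifferentiableAt ℝ ω l₀) (hωpos : ω l₀ > 0)
    (xt : ℝ × ℝ → (Fin n → ℝ)) (hxt : ContDiff ℝ 1 xt)
    (q : ℝ × ℝ → (Fin n → ℝ)) (hq : ContDiff ℝ 2 q)
    (A : ℝ → ℝ → Matrix (Fin n) (Fin n) ℝ)
    (hA : ∀ θ l i j, A θ l i j =
      fderiv ℝ (fun y => f (y, l) i) (xt (θ, l)) (Pi.single j 1))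
    (hadj : ∀ θ : ℝ, ∀ᶠ l in nhds l₀,
      ω l • deriv (fun s => q (s, l)) θ = -(A θ l).transpose.mulVec (q (θ, l)))
    (Z Zq : ℝ → (Fin n → ℝ))
    (hZ : ∀ θ, Z θ = deriv (fun l => xt (θ, l)) l₀)
    (hZq : ∀ θ, Zq θ = deriv (fun l => q (θ, l)) l₀)
    (C : ℝ → Matrix (Fin n) (Fin n) ℝ)
    (hC : ∀ θ i j, C θ i j =
      (∑ k, fderiv ℝ
          (fun y => fderiv ℝ (fun z => f (z, l₀) i) y (Pi.single j 1))
          (xt (θ, l₀)) (Pi.single k 1) * Z θ k)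
      + deriv (fun l => fderiv ℝ (fun z => f (z, l) i) (xt (θ, l₀)) (Pi.single j 1)) l₀
      - (deriv ω l₀ / ω l₀) *
          fderiv ℝ (fun z => f (z, l₀) i) (xt (θ, l₀)) (Pi.single j 1)) :
    ∀ θ : ℝ, HasDerivAt Zq
      (-((1 / ω l₀) • (A θ l₀).transpose.mulVec (Zq θ)
         + (1 / ω l₀) • (C θ).transpose.mulVec (q (θ, l₀)))) θ := by
  intro θ
  have hl (g : ℝ × ℝ → (Fin n → ℝ)) (hg : Differentiable ℝ g) (s l : ℝ) :
      HasDerivAt (fun l => g (s, l)) (fderiv ℝ g (s, l) (0, 1)) l :=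
    (hg (s, l)).hasFDerivAt.comp_hasDerivAt l ((hasDerivAt_const l s).prodMk (hasDerivAt_id l))
  have hs (g : ℝ × ℝ → (Fin n → ℝ)) (hg : Differentiable ℝ g) (s l : ℝ) :
      HasDerivAt (fun s => g (s, l)) (fderiv ℝ g (s, l) (1, 0)) s :=
    (hg (s, l)).hasFDerivAt.comp_hasDerivAt s ((hasDerivAt_id s).prodMk (hasDerivAt_const s l))
  have hqd : Differentiable ℝ q := hq.differentiable (by norm_num)
  have hxd : Differentiable ℝ xt := hxt.differentiable (by norm_num)
  have hDq : Differentiable ℝ (fderiv ℝ q) :=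
    (hq.fderiv_right (m := 1) (by norm_num)).differentiable (by norm_num)
  have hDf : Differentiable ℝ (fderiv ℝ f) :=
    (hf.fderiv_right (m := 1) (by norm_num)).differentiable (by norm_num)
  have hDqv (v : ℝ × ℝ) : Differentiable ℝ (fun p => fderiv ℝ q p v) := fun p =>
    (hDq p).clm_apply (differentiableAt_const v)
  have hDqv' (v w p : ℝ × ℝ) : fderiv ℝ (fun p => fderiv ℝ q p v) p w
      = fderiv ℝ (fderiv ℝ q) p w v := by
    rw [fderiv_clm_apply (hDq p) (differentiableAt_const v)]
    simp
  have hsymm : fderiv ℝ (fderiv ℝ q) (θ, l₀) (1, 0) (0, 1)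
      = fderiv ℝ (fderiv ℝ q) (θ, l₀) (0, 1) (1, 0) :=
    (hq.contDiffAt.isSymmSndFDerivAt (by simp)).eq _ _
  have hZq' : Zq = fun s => fderiv ℝ q (s, l₀) (0, 1) := by
    funext s
    rw [hZq]
    exact (hl q hqd s l₀).deriv
  have hZqd : HasDerivAt Zq (fderiv ℝ (fderiv ℝ q) (θ, l₀) (0, 1) (1, 0)) θ := by
    rw [hZq', ← hsymm, ← hDqv']
    exact hs _ (hDqv (0, 1)) θ l₀
  convert hZqd using 1
  -- derivative of the entries of A
  have hG (i j : Fin n) : Differentiable ℝ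
      (fun p => fderiv ℝ f p (Pi.single j 1, 0) i) := fun p =>
    differentiableAt_pi.1 ((hDf p).clm_apply (differentiableAt_const _)) i
  have hZθ : HasDerivAt (fun l => xt (θ, l)) (Z θ) l₀ := by
    rw [hZ]
    exact (hl xt hxd θ l₀).differentiableAt.hasDerivAt
  have hAd (i j : Fin n) : HasDerivAt (fun l => A θ l i j)
      (C θ i j + (deriv ω l₀ / ω l₀) * A θ l₀ i j) l₀ := by
    have e : (fun l => A θ l i j) =
        fun l => fderiv ℝ f (xt (θ, l), l) (Pi.single j 1, 0) i := by
      funext l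
      rw [hA, aux_G f hf]
    have h1 := (hG i j (xt (θ, l₀), l₀)).hasFDerivAt
    have h2 := h1.comp_hasDerivAt (f := fun l => (xt (θ, l), l)) l₀ (hZθ.prodMk (hasDerivAt_id l₀))
    have h3 := h1.comp_hasDerivAt (f := fun l => (xt (θ, l₀), l)) l₀
      ((hasDerivAt_const l₀ (xt (θ, l₀))).prodMk (hasDerivAt_id l₀))
    have h4 := HasFDerivAt.comp (f := fun y : Fin n → ℝ => (y, l₀)) (xt (θ, l₀)) h1
      (hasFDerivAt_prodMk_left (xt (θ, l₀)) l₀)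
    rw [e]
    refine HasDerivAt.congr_deriv h2 (Eq.symm ?_)
    rw [hC, hA]
    simp only [aux_G f hf]
    rw [aux_sum]
    have h3' : deriv (fun l => fderiv ℝ f (xt (θ, l₀), l) (Pi.single j 1, 0) i) l₀ = _ :=
      h3.deriv
    have h4' : fderiv ℝ (fun y => fderiv ℝ f (y, l₀) (Pi.single j 1, 0) i) (xt (θ, l₀)) = _ :=
      h4.fderiv
    rw [h3', h4', sub_add_cancel]
    simp only [ContinuousLinearMap.comp_apply, ContinuousLinearMap.inl_apply]
    rw [← map_add]
    simp
  funext j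
  have hL : HasDerivAt (fun l => ω l * fderiv ℝ q (θ, l) (1, 0) j)
      (deriv ω l₀ * fderiv ℝ q (θ, l₀) (1, 0) j
        + ω l₀ * fderiv ℝ (fderiv ℝ q) (θ, l₀) (0, 1) (1, 0) j) l₀ := by
    refine hω.hasDerivAt.mul ?_
    rw [← hDqv']
    exact hasDerivAt_pi.1 (hl _ (hDqv (1, 0)) θ l₀) j
  have hR : HasDerivAt (fun l => -∑ i, A θ l i j * q (θ, l) i)
      (-∑ i, ((C θ i j + (deriv ω l₀ / ω l₀) * A θ l₀ i j) * q (θ, l₀) i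
        + A θ l₀ i j * Zq θ i)) l₀ := by
    refine (HasDerivAt.fun_sum fun i _ => ?_).neg
    refine (hAd i j).mul ?_
    rw [hZq']
    exact hasDerivAt_pi.1 (hl q hqd θ l₀) i
  have hev : ∀ᶠ l in nhds l₀, ω l * fderiv ℝ q (θ, l) (1, 0) j
      = -∑ i, A θ l i j * q (θ, l) i := by
    filter_upwards [hadj θ] with l h
    have h' := congrFun h j
    rw [(hs q hqd θ l).deriv] at h'
    simpa [Matrix.mulVec, dotProduct] using h'
  have h0 := hev.self_of_nhds
  have hU := hL.unique (hR.congr_of_eventuallyEq hev)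
  have hne := hωpos.ne'
  simp only [Pi.neg_apply, Pi.add_apply, Pi.smul_apply, smul_eq_mul, Matrix.mulVec, dotProduct,
    Matrix.transpose_apply]
  have hsum : ∑ i, ((C θ i j + (deriv ω l₀ / ω l₀) * A θ l₀ i j) * q (θ, l₀) i
        + A θ l₀ i j * Zq θ i) = ∑ i, C θ i j * q (θ, l₀) i
        + (deriv ω l₀ / ω l₀) * ∑ i, A θ l₀ i j * q (θ, l₀) i
        + ∑ i, A θ l₀ i j * Zq θ i := by
    rw [Finset.mul_sum, ← Finset.sum_add_distrib, ← Finset.sum_add_distrib]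
    exact Finset.sum_congr rfl fun i _ => by ring
  rw [hsum, ← neg_eq_iff_eq_neg.2 h0] at hU
  field_simp at hU ⊢
  linarith
end
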